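/- The partial order π on the set V' (constructed below) has width exactly k + 1. In particular, {s^1,...,s^{k+1}} is an antichain of π of size k + 1, and V' can be partitioned into the k + 1 chains {s, s^1} ∪ W^1, the sets X^i ∪ {s^{i+1}} ∪ W^{i+1} for i ∈ {1,...,k−1}, and X^k ∪ {s^{k+1}, z, t} ∪ Y. -/

import Mathlib

/-- The vertex set `V'` of the reduction graph `G'`.  Indices are `0`-based:
`sup i` is `s^{i+1}`, `x i j` is `x^{i+1}_{j+1}`, `w i p l` is `w^{i+1}_{p+1, l}`,
`y j` is `y_{j+1}`. -/
inductive Vp (k q : ℕ) : Type where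
  | s : Vp k q
  | t : Vp k q
  | z : Vp k q
  | y : Fin (q * (k + 1) * k) → Vp k q
  | sup : Fin (k + 1) → Vp k q
  | x : Fin k → Fin ((k + 1) * q) → Vp k q
  | w : Fin k → Fin q → Fin (k + 1) → Vp k q
deriving DecidableEq

/-- The generating relations (P1)–(P9) of the partial order `π` on `V'`. -/
inductive PBase (k q : ℕ) : Vp k q → Vp k q → Prop where
  | p1 (a : Vp k q) : a ≠ .s → PBase k q .s a
  | p2 (i : Fin k) (p : Fin q) (l : Fin (k + 1)) :
      PBase k q (.sup i.castSucc) (.w i p l)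
  | p3 (i : Fin k) (p r : Fin q) (j l : Fin (k + 1)) :
      (p < r ∨ (p = r ∧ j < l)) → PBase k q (.w i p j) (.w i r l)
  | p4 (i : Fin k) (j l : Fin ((k + 1) * q)) : j < l → PBase k q (.x i j) (.x i l)
  | p5 (i : Fin k) (j : Fin ((k + 1) * q)) : PBase k q (.x i j) (.sup i.succ)
  | p6 (j l : Fin (q * (k + 1) * k)) : j < l → PBase k q (.y j) (.y l)
  | p7 : PBase k q (.sup (Fin.last k)) .z
  | p8 : PBase k q .z .t
  | p9 (j : Fin (q * (k + 1) * k)) : PBase k q .t (.y j)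

/-- The partial order `π` on `V'`: the reflexive-transitive closure of (P1)–(P9). -/
def PiOrd (k q : ℕ) : Vp k q → Vp k q → Prop := Relation.ReflTransGen (PBase k q)

/-- The generating relations (E1)–(E11) for the edges of `G'`, given the
`k`-colored graph `G` on vertex set `Fin k × Fin q` (vertex `(i, p)` is `v^{i+1}_{p+1}`). -/
inductive ERel (k q : ℕ) (G : SimpleGraph (Fin k × Fin q)) : Vp k q → Vp k q → Prop where
  | e1 (i : Fin (k + 1)) : (i : ℕ) = 0 → ERel k q G .s (.sup i)
  | e2 (i : Fin (k + 1)) : (i : ℕ) = k → ERel k q G .z (.sup i)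
  | e3y (j l : Fin (q * (k + 1) * k)) : ERel k q G (.y j) (.y l)
  | e3w (j : Fin (q * (k + 1) * k)) (i : Fin k) (p : Fin q) (l : Fin (k + 1)) :
      ERel k q G (.y j) (.w i p l)
  | e4x (i : Fin k) (j l : Fin ((k + 1) * q)) : ERel k q G (.x i j) (.x i l)
  | e4s (i : Fin k) (j : Fin ((k + 1) * q)) : ERel k q G (.x i j) (.sup i.castSucc)
  | e4w (i : Fin k) (j : Fin ((k + 1) * q)) (p : Fin q) (l : Fin (k + 1)) :
      ERel k q G (.x i j) (.w i p l)
  | e5 (i : Fin k) (p : Fin q) (l : Fin (k + 1)) : (l : ℕ) = 0 →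
      ERel k q G (.w i p l) (.sup i.succ)
  | e6 (i : Fin k) (p : Fin q) (l : Fin (k + 1)) : (i : ℕ) = 0 → (l : ℕ) = 1 →
      ERel k q G .z (.w i p l)
  | e7 (i j : Fin k) (p r : Fin q) (li lj : Fin (k + 1)) :
      i ≠ j → G.Adj (i, p) (j, r) → (li : ℕ) = (j : ℕ) + 1 → (lj : ℕ) = (i : ℕ) + 1 →
      ERel k q G (.w i p li) (.w j r lj)
  | e8 (i j : Fin k) (p r : Fin q) (li lj : Fin (k + 1)) :
      i < j → G.Adj (i, p) (j, r) → (li : ℕ) = (j : ℕ) → (lj : ℕ) = (i : ℕ) + 1 →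
      ERel k q G (.w i p li) (.w j r lj)
  | e9 (i j : Fin k) (p r : Fin q) (li lj : Fin (k + 1)) :
      (j : ℕ) = (i : ℕ) + 1 → G.Adj (i, p) (j, r) → (li : ℕ) = k → (lj : ℕ) = (i : ℕ) + 2 →
      ERel k q G (.w i p li) (.w j r lj)
  | e10 (i : Fin k) (p : Fin q) (l : Fin (k + 1)) : (i : ℕ) = k - 1 → (l : ℕ) = k →
      ERel k q G (.w i p l) .t
  | e11 (j : Fin (q * (k + 1) * k)) : ERel k q G .t (.y j)

/-- The reduction graph `G'`. -/
def Gp (k q : ℕ) (G : SimpleGraph (Fin k × Fin q)) : SimpleGraph (Vp k q) :=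
  SimpleGraph.fromRel (ERel k q G)

/-- Assignment of each vertex of `V'` to one of `k + 1` chains:
chain `0` is `{s, s^1} ∪ W^1`, chain `i` (for `1 ≤ i ≤ k - 1`) is
`X^i ∪ {s^{i+1}} ∪ W^{i+1}`, and chain `k` is `X^k ∪ {s^{k+1}, z, t} ∪ Y`. -/
def chainIdx (k q : ℕ) : Vp k q → Fin (k + 1)
  | .s => 0
  | .t => Fin.last k
  | .z => Fin.last k
  | .y _ => Fin.last k
  | .sup i => i
  | .x i _ => i.succ
  | .w i _ _ => i.castSucc

theorem reach_sup (k q : ℕ) (i : Fin (k + 1)) (b : Vp k q) (h : PiOrd k q (.sup i) b) :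
    b = .sup i ∨ (∃ j p l, b = .w j p l) ∨ b = .z ∨ b = .t ∨ ∃ j, b = .y j := by
  induction h with
  | refl => exact Or.inl rfl
  | tail _ hb ih => cases hb <;> simp_all

/-- The index of the level of a vertex within its chain. -/
def lev (k q : ℕ) : Vp k q → ℕ
  | .s => 0
  | .x _ _ => 1
  | .sup _ => 2
  | .w _ _ _ => 3
  | .z => 4
  | .t => 5
  | .y _ => 6

theorem chain_le (k q : ℕ) (u v : Vp k q) (h : chainIdx k q u = chainIdx k q v)
    (hl : lev k q u ≤ lev k q v) : PiOrd k q u v ∨ PiOrd k q v u := by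
  have zt : PiOrd k q .z .t := .single .p8
  have sz : PiOrd k q (.sup (Fin.last k)) .z := .single .p7
  have ty : ∀ j, PiOrd k q .t (.y j) := fun j => .single (.p9 j)
  have xs : ∀ i j, PiOrd k q (.x i j) (.sup i.succ) := fun i j => .single (.p5 i j)
  have sw : ∀ i p l, PiOrd k q (.sup i.castSucc) (.w i p l) := fun i p l => .single (.p2 i p l)
  have tr : ∀ {a b c : Vp k q}, PiOrd k q a b → PiOrd k q b c → PiOrd k q a c :=
    fun h1 h2 => Relation.ReflTransGen.trans h1 h2
  have rf : ∀ a : Vp k q, PiOrd k q a a := fun a => .refl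
  by_cases hus : u = .s
  · subst hus
    by_cases hv : v = .s
    · subst hv; exact Or.inl (rf _)
    · exact Or.inl (.single (.p1 v hv))
  cases u with
  | s => exact absurd rfl hus
  | t =>
    cases v <;> simp [lev] at hl
    · exact Or.inl (rf _)
    · exact Or.inl (ty _)
  | z =>
    cases v <;> simp [lev] at hl
    · exact Or.inl zt
    · exact Or.inl (rf _)
    · exact Or.inl (tr zt (ty _))
  | y j =>
    cases v <;> simp [lev] at hl
    rename_i l
    rcases lt_trichotomy j l with h1 | h1 | h1
    · exact Or.inl (.single (.p6 _ _ h1))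
    · subst h1; exact Or.inl (rf _)
    · exact Or.inr (.single (.p6 _ _ h1))
  | sup i =>
    cases v <;> simp [lev] at hl <;> simp only [chainIdx] at h <;> subst h
    · exact Or.inl (tr sz zt)
    · exact Or.inl sz
    · exact Or.inl (tr sz (tr zt (ty _)))
    · exact Or.inl (rf _)
    · exact Or.inl (sw _ _ _)
  | x i j =>
    have hx := xs i j
    cases v <;> simp [lev] at hl <;> simp only [chainIdx] at h
    case x a b =>
      have := Fin.succ_injective _ h
      subst this
      rcases lt_trichotomy j b with h1 | h1 | h1
      · exact Or.inl (.single (.p4 _ _ _ h1))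
      · subst h1; exact Or.inl (rf _)
      · exact Or.inr (.single (.p4 _ _ _ h1))
    all_goals rw [h] at hx
    · exact Or.inl (tr hx (tr sz zt))
    · exact Or.inl (tr hx sz)
    · exact Or.inl (tr hx (tr sz (tr zt (ty _))))
    · exact Or.inl hx
    · exact Or.inl (tr hx (sw _ _ _))
  | w i p l =>
    cases v <;> simp [lev] at hl <;> simp only [chainIdx] at h
    case w a r m =>
      have := Fin.castSucc_injective _ h
      subst this
      rcases lt_trichotomy p r with h1 | h1 | h1
      · exact Or.inl (.single (.p3 _ _ _ _ _ (Or.inl h1)))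
      · subst h1
        rcases lt_trichotomy l m with h1 | h1 | h1
        · exact Or.inl (.single (.p3 _ _ _ _ _ (Or.inr ⟨rfl, h1⟩)))
        · subst h1; exact Or.inl (rf _)
        · exact Or.inr (.single (.p3 _ _ _ _ _ (Or.inr ⟨rfl, h1⟩)))
      · exact Or.inr (.single (.p3 _ _ _ _ _ (Or.inl h1)))
    all_goals exact absurd h (Fin.castSucc_lt_last i).ne

theorem chain_all (k q : ℕ) (u v : Vp k q) (h : chainIdx k q u = chainIdx k q v) :
    PiOrd k q u v ∨ PiOrd k q v u := by
  rcases le_total (lev k q u) (lev k q v) with hl | hl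
  · exact chain_le k q u v h hl
  · exact (chain_le k q v u h.symm hl).symm

/-- The partial order `π` on `V'` has width exactly `k + 1`:
`{s^1, …, s^{k+1}}` is an antichain of size `k + 1`, every antichain of `π` has at most
`k + 1` elements, and `V'` is partitioned into the `k + 1` chains `{s, s^1} ∪ W^1`,
`X^i ∪ {s^{i+1}} ∪ W^{i+1}` for `i ∈ {1, …, k-1}`, and `X^k ∪ {s^{k+1}, z, t} ∪ Y`
(the fibers of `chainIdx`). -/
theorem stmt_7 (k q : ℕ) (hk : 2 ≤ k) (hq : 1 ≤ q) :
    (∀ i j : Fin (k + 1), i ≠ j → ¬ PiOrd k q (.sup i) (.sup j)) ∧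
    ((Finset.univ.image (Vp.sup (k := k) (q := q))).card = k + 1) ∧
    (∀ T : Finset (Vp k q),
      (∀ u ∈ T, ∀ v ∈ T, u ≠ v → ¬ PiOrd k q u v ∧ ¬ PiOrd k q v u) →
      T.card ≤ k + 1) ∧
    (∀ u v : Vp k q, chainIdx k q u = chainIdx k q v →
      PiOrd k q u v ∨ PiOrd k q v u) := by
  refine ⟨?_, ?_, ?_, chain_all k q⟩
  · intro i j hij h
    have := reach_sup k q i _ h
    simp at this
    exact hij this.symm
  · rw [Finset.card_image_of_injective _ (fun a b h => by simpa using h)]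
    simp
  · intro T hT
    have hc : T.card ≤ (Finset.univ : Finset (Fin (k + 1))).card := by
      refine Finset.card_le_card_of_injOn (chainIdx k q) (fun _ _ => by simp) ?_
      intro u hu v hv huv
      by_contra hne
      have h1 := hT u hu v hv hne
      rcases chain_all k q u v huv with h2 | h2
      · exact h1.1 h2
      · exact h1.2 h2
    simpa using hc
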